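/- arXiv:1909.02198 — 6 statements merged into one kernel-verified Lean document; each statement's English description precedes it below -/
import Mathlib

section
/- Suppose every element of every set D_{s s'} is strictly positive, let C = ⋃_{s, s'} D_{s s'} be nonempty with minimum c_min and maximum c_max. Then for every k with k · c_min > c_max, P^{k+1}_s = P^k_s for every state s, and consequently P^j_s = P^k_s for all j ≥ k. In particular the subdomain recursion stabilizes after at most ⌈c_max / c_min⌉ + 1 iterations. -/
/-- The subdomain sets of the piecewise-constant travel-time recursion:
`P⁰_s = {0}` and
`P^{k+1}_s = {0} ∪ ⋃_{s'} D_{s s'} ∪ ⋃_{s'} { p − d | p ∈ P^k_{s'}, d ∈ D_{s s'}, p − d ≥ 0 }`. -/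
def subP {S : Type*} (D : S → S → Finset ℝ) : ℕ → S → Set ℝ
  | 0, _ => {0}
  | k + 1, s =>
      {0} ∪ (⋃ s' : S, (D s s' : Set ℝ)) ∪
        ⋃ s' : S, {x : ℝ | ∃ p ∈ subP D k s', ∃ d ∈ D s s', x = p - d ∧ 0 ≤ x}

theorem subP_mono_aux {S : Type*} (D : S → S → Finset ℝ) (k : ℕ) :
    ∀ s, subP D k s ⊆ subP D (k + 1) s := by
  induction k with
  | zero =>
    intro s x hx
    simp only [subP] at hx ⊢
    exact Or.inl (Or.inl hx)
  | succ k ih =>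
    intro s x hx
    rw [subP] at hx ⊢
    rcases hx with hx | hx
    · exact Or.inl hx
    · right
      simp only [Set.mem_iUnion, Set.mem_setOf_eq] at hx ⊢
      obtain ⟨s', p, hp, d, hd, h⟩ := hx
      exact ⟨s', p, ih s' hp, d, hd, h⟩

theorem subP_new_aux {S : Type*} (D : S → S → Finset ℝ) (a b : ℝ)
    (hpos : ∀ s s', ∀ d ∈ D s s', (0 : ℝ) < d)
    (ha : ∀ s s', ∀ d ∈ D s s', a ≤ d) (hb : ∀ s s', ∀ d ∈ D s s', d ≤ b) (k : ℕ) :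
    ∀ s, ∀ x ∈ subP D (k + 1) s, x ∈ subP D k s ∨ (0 ≤ x ∧ x + k * a ≤ b) := by
  induction k with
  | zero =>
    intro s x hx
    rw [subP] at hx
    rcases hx with (hx | hx) | hx
    · exact Or.inl hx
    · right
      simp only [Set.mem_iUnion, Finset.mem_coe] at hx
      obtain ⟨s', hx⟩ := hx
      have h1 := hb _ _ _ hx
      have h2 := hpos _ _ _ hx
      exact ⟨h2.le, by simpa using h1⟩
    · simp only [Set.mem_iUnion, Set.mem_setOf_eq] at hx
      obtain ⟨s', p, hp, d, hd, h, h0⟩ := hx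
      have hp0 : p = 0 := hp
      have h2 := hpos _ _ _ hd
      linarith
  | succ k ih =>
    intro s x hx
    rw [subP] at hx
    rcases hx with hx | hx
    · left
      rw [subP]
      exact Or.inl hx
    · simp only [Set.mem_iUnion, Set.mem_setOf_eq] at hx
      obtain ⟨s', p, hp, d, hd, h, h0⟩ := hx
      rcases ih s' p hp with hp' | ⟨_, hp'⟩
      · left
        rw [subP]
        right
        simp only [Set.mem_iUnion, Set.mem_setOf_eq]
        exact ⟨s', p, hp', d, hd, h, h0⟩
      · right
        refine ⟨h0, ?_⟩
        have h2 := ha _ _ _ hd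
        push_cast
        linarith

/-- suppose every element of every `D_{s s'}` is strictly positive and
`C = ⋃_{s,s'} D_{s s'}` is nonempty with minimum `c_min` and maximum `c_max`. Then for
every `k` with `k · c_min > c_max` we have `P^{k+1}_s = P^k_s` for every state `s`, and
consequently `P^j_s = P^k_s` for all `j ≥ k`. In particular the recursion stabilizes
after at most `⌈c_max / c_min⌉ + 1` iterations. -/
theorem subP_stabilizes {S : Type*} [Fintype S] (D : S → S → Finset ℝ)
    (hpos : ∀ s s', ∀ d ∈ D s s', (0 : ℝ) < d)
    (C : Finset ℝ) (hC : ∀ x : ℝ, x ∈ C ↔ ∃ s s', x ∈ D s s')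
    (hne : C.Nonempty) :
    (∀ k : ℕ, C.max' hne < (k : ℝ) * C.min' hne →
      (∀ s : S, subP D (k + 1) s = subP D k s) ∧
      ∀ j ≥ k, ∀ s : S, subP D j s = subP D k s) ∧
    ∀ j ≥ ⌈C.max' hne / C.min' hne⌉₊ + 1, ∀ s : S,
      subP D j s = subP D (⌈C.max' hne / C.min' hne⌉₊ + 1) s := by
  have ha : ∀ s s', ∀ d ∈ D s s', C.min' hne ≤ d := fun s s' d hd =>
    C.min'_le d ((hC d).2 ⟨s, s', hd⟩)
  have hb : ∀ s s', ∀ d ∈ D s s', d ≤ C.max' hne := fun s s' d hd =>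
    C.le_max' d ((hC d).2 ⟨s, s', hd⟩)
  have hstep : ∀ k : ℕ, C.max' hne < (k : ℝ) * C.min' hne →
      ∀ s : S, subP D (k + 1) s = subP D k s := by
    intro k hk s
    refine Set.Subset.antisymm (fun x hx => ?_) (subP_mono_aux D k s)
    rcases subP_new_aux D _ _ hpos ha hb k s x hx with h | ⟨h0, h⟩
    · exact h
    · linarith
  have hmin : 0 < C.min' hne := by
    obtain ⟨s, s', h⟩ := (hC _).1 (C.min'_mem hne)
    exact hpos _ _ _ h
  have hall : ∀ k : ℕ, C.max' hne < (k : ℝ) * C.min' hne →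
      ∀ j ≥ k, ∀ s : S, subP D j s = subP D k s := by
    intro k hk j hj
    induction j, hj using Nat.le_induction with
    | base => intro s; rfl
    | succ j hj ih =>
      intro s
      rw [← ih s]
      refine hstep j (hk.trans_le ?_) s
      have : (k : ℝ) ≤ j := by exact_mod_cast hj
      gcongr
  refine ⟨fun k hk => ⟨hstep k hk, hall k hk⟩, hall _ ?_⟩
  rw [← div_lt_iff₀ hmin]
  push_cast
  exact (Nat.le_ceil _).trans_lt (lt_add_one _)
end

section
/- Suppose every element of every set D_{s s'} is strictly positive and ⋃_{s, s'} D_{s s'} is nonempty. Then for every state s, each subdomain set P^k_s is finite, and the sequence (P^k_s)_{k ≥ 0} is eventually constant: there exists a finite K such that P^k_s = P^K_s for all k ≥ K and all s ∈ S. -/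
theorem subP_mem_succ {S : Type*} (D : S → S → Finset ℝ) (k : ℕ) (s : S) (x : ℝ) :
    x ∈ subP D (k + 1) s ↔ x = 0 ∨ (∃ s', x ∈ D s s') ∨
      ∃ s', ∃ p ∈ subP D k s', ∃ d ∈ D s s', x = p - d ∧ 0 ≤ x := by
  simp only [subP, Set.mem_union, Set.mem_singleton_iff, Set.mem_iUnion, Finset.mem_coe,
    Set.mem_setOf_eq, or_assoc]

theorem subP_mono_step {S : Type*} (D : S → S → Finset ℝ) (k : ℕ) :
    ∀ s x, x ∈ subP D k s → x ∈ subP D (k + 1) s := by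
  induction k with
  | zero =>
    intro s x hx
    rw [subP_mem_succ]
    left
    simpa [subP] using hx
  | succ k ih =>
    intro s x hx
    rw [subP_mem_succ] at hx ⊢
    rcases hx with h | h | ⟨s', p, hp, h⟩
    · exact Or.inl h
    · exact Or.inr (Or.inl h)
    · exact Or.inr (Or.inr ⟨s', p, ih _ _ hp, h⟩)

theorem subP_new_le {S : Type*} (D : S → S → Finset ℝ) (m M : ℝ) (hm : 0 < m)
    (hD : ∀ s s', ∀ d ∈ D s s', m ≤ d ∧ d ≤ M) (k : ℕ) :
    ∀ s x, x ∈ subP D (k + 1) s → x ∉ subP D k s → x ≤ M - k * m := by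
  induction k with
  | zero =>
    intro s x hx hn
    rw [subP_mem_succ] at hx
    rcases hx with h | ⟨s', h⟩ | ⟨s', p, hp, d, hd, h, h0⟩
    · exact absurd (by simpa [subP] using h) hn
    · simpa using (hD _ _ _ h).2
    · have hp0 : p = 0 := by simpa [subP] using hp
      have := (hD _ _ _ hd).1
      linarith
  | succ k ih =>
    intro s x hx hn
    rw [subP_mem_succ] at hx
    rw [subP_mem_succ] at hn
    rcases hx with h | h | ⟨s', p, hp, d, hd, h, h0⟩
    · exact absurd (Or.inl h) hn
    · exact absurd (Or.inr (Or.inl h)) hn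
    · have hpn : p ∉ subP D k s' := fun hp' =>
        hn (Or.inr (Or.inr ⟨s', p, hp', d, hd, h, h0⟩))
      have h1 := ih _ _ hp hpn
      have h2 := (hD _ _ _ hd).1
      push_cast
      linarith

/-- if every element of every `D_{s s'}` is strictly positive and
`⋃_{s,s'} D_{s s'}` is nonempty, then each subdomain set `P^k_s` is finite and the
sequence `(P^k_s)_{k ≥ 0}` is eventually constant: there is a finite `K` with
`P^k_s = P^K_s` for all `k ≥ K` and all states `s`. -/
theorem subP_finite_and_eventually_constant {S : Type*} [Fintype S]
    (D : S → S → Finset ℝ)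
    (hpos : ∀ s s', ∀ d ∈ D s s', (0 : ℝ) < d)
    (hne : ∃ s s', (D s s').Nonempty) :
    (∀ (k : ℕ) (s : S), (subP D k s).Finite) ∧
    ∃ K : ℕ, ∀ k ≥ K, ∀ s : S, subP D k s = subP D K s := by
  constructor
  · intro k
    induction k with
    | zero => intro s; simp [subP]
    | succ k ih =>
      intro s
      simp only [subP]
      refine ((Set.finite_singleton _).union
        (Set.finite_iUnion fun s' => (D s s').finite_toSet)).union (Set.finite_iUnion fun s' => ?_)
      refine (Set.Finite.image2 (fun p d : ℝ => p - d) (ih s') (D s s').finite_toSet).subset ?_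
      rintro x ⟨p, hp, d, hd, h, -⟩
      exact ⟨p, hp, d, hd, h.symm⟩
  · classical
    let U : Finset ℝ := Finset.univ.biUnion fun q : S × S => D q.1 q.2
    have hU : ∀ s s', ∀ d ∈ D s s', d ∈ U := fun s s' d hd =>
      Finset.mem_biUnion.2 ⟨(s, s'), Finset.mem_univ _, hd⟩
    have hUne : U.Nonempty := by
      obtain ⟨s, s', d, hd⟩ := hne
      exact ⟨d, hU s s' d hd⟩
    have hm : 0 < U.min' hUne := by
      obtain ⟨q, -, hq⟩ := Finset.mem_biUnion.1 (U.min'_mem hUne)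
      exact hpos _ _ _ hq
    have hD : ∀ s s', ∀ d ∈ D s s', U.min' hUne ≤ d ∧ d ≤ U.max' hUne := fun s s' d hd =>
      ⟨U.min'_le _ (hU s s' d hd), U.le_max' _ (hU s s' d hd)⟩
    obtain ⟨K, hK⟩ := exists_nat_gt (U.max' hUne / U.min' hUne)
    rw [div_lt_iff₀ hm] at hK
    refine ⟨K, fun k hk => ?_⟩
    induction k, hk using Nat.le_induction with
    | base => intro s; rfl
    | succ k hk ih =>
      intro s
      rw [← ih s]
      refine Set.Subset.antisymm (fun x hx => ?_) (subP_mono_step D k s)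
      by_contra hn
      have h1 := subP_new_le D _ _ hm hD k s x hx hn
      have h2 : (K : ℝ) * U.min' hUne ≤ k * U.min' hUne := by gcongr
      have h3 : 0 ≤ x := by
        rw [subP_mem_succ] at hx
        rcases hx with h | ⟨s', h⟩ | ⟨s', p, hp, d, hd, h, h0⟩
        · exact h.ge
        · exact (hpos _ _ _ h).le
        · exact h0
      linarith
end

section
/- Let c : ℝ → [0, ∞] be piecewise constant with respect to the finite set P_c ⊆ ℝ, with all of its finite values contained in a finite set V ⊆ [0, ∞), and let f : ℝ → [0, ∞] be piecewise constant with respect to the finite set P_f ⊆ ℝ. Then the function h(t) = c(t) + f(t + c(t)) (defined to be ∞ wherever c(t) = ∞) is piecewise constant with respect to the finite set P_c ∪ { p − v | p ∈ P_f, v ∈ V }. -/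
open ENNReal

/-- `f : ℝ → [0, ∞]` is piecewise constant with respect to `P ⊆ ℝ` if `f` is
constant on every connected component of `ℝ \ P`. -/
def PiecewiseConstantWrt (f : ℝ → ℝ≥0∞) (P : Set ℝ) : Prop :=
  ∀ x ∈ Pᶜ, ∀ y ∈ connectedComponentIn Pᶜ x, f y = f x

/-- if `c : ℝ → [0, ∞]` is piecewise constant w.r.t. the finite set
`P_c`, with all of its finite values contained in a finite set `V ⊆ [0, ∞)`, and
`f : ℝ → [0, ∞]` is piecewise constant w.r.t. the finite set `P_f`, then
`h(t) = c(t) + f(t + c(t))` (equal to `∞` wherever `c(t) = ∞`) is piecewise constant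
w.r.t. `P_c ∪ { p − v | p ∈ P_f, v ∈ V }`. -/
theorem piecewiseConstant_recursion (c f : ℝ → ℝ≥0∞) (Pc Pf : Set ℝ) (V : Finset ℝ)
    (hPc : Pc.Finite) (hPf : Pf.Finite)
    (hV : ∀ v ∈ V, (0 : ℝ) ≤ v)
    (hc : PiecewiseConstantWrt c Pc)
    (hcV : ∀ t : ℝ, c t ≠ ⊤ → ∃ v ∈ V, c t = ENNReal.ofReal v)
    (hf : PiecewiseConstantWrt f Pf) :
    PiecewiseConstantWrt
      (fun t => if c t = ⊤ then ⊤ else c t + f (t + (c t).toReal))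
      (Pc ∪ {x : ℝ | ∃ p ∈ Pf, ∃ v ∈ V, x = p - v}) := by
  intro x hx y hy
  have hxPc : x ∈ Pcᶜ := fun h => hx (Or.inl h)
  have hcy : c y = c x := by
    refine hc x hxPc y (connectedComponentIn_mono x ?_ hy)
    exact Set.compl_subset_compl.mpr Set.subset_union_left
  by_cases hT : c x = ⊤
  · simp [hcy, hT]
  · obtain ⟨v, hv, hcv⟩ := hcV x hT
    have htr : (c x).toReal = v := by rw [hcv, ENNReal.toReal_ofReal (hV v hv)]
    have hsub : (fun t : ℝ => t + v) '' connectedComponentIn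
        (Pc ∪ {x : ℝ | ∃ p ∈ Pf, ∃ v ∈ V, x = p - v})ᶜ x ⊆ Pfᶜ := by
      rintro _ ⟨t, ht, rfl⟩ hmem
      exact connectedComponentIn_subset _ _ ht (Or.inr ⟨t + v, hmem, v, hv, by ring⟩)
    have hpre : IsPreconnected ((fun t : ℝ => t + v) '' connectedComponentIn
        (Pc ∪ {x : ℝ | ∃ p ∈ Pf, ∃ v ∈ V, x = p - v})ᶜ x) :=
      isPreconnected_connectedComponentIn.image _ (by fun_prop)
    have hxm : x + v ∈ (fun t : ℝ => t + v) '' connectedComponentIn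
        (Pc ∪ {x : ℝ | ∃ p ∈ Pf, ∃ v ∈ V, x = p - v})ᶜ x :=
      ⟨x, mem_connectedComponentIn hx, rfl⟩
    have hfy : f (y + v) = f (x + v) :=
      hf (x + v) (hsub hxm) (y + v)
        (hpre.subset_connectedComponentIn hxm hsub ⟨y, hy, rfl⟩)
    simp only [hcy, if_neg hT, htr, hfy]
end

section
/- In a time-dependent graph, suppose there is c_min > 0 such that every finite value of every edge travel time function c_{s s'} is at least c_min. Fix a state s and a departure time t, and suppose some path from s to a goal state has finite travel time T at departure time t. Then every path from s to a goal state with more than T / c_min edges has travel time strictly greater than T at departure time t; consequently, the infimum of travel time over all paths from s to a goal state at departure time t is attained by a path with at most ⌊T / c_min⌋ edges. In particular, optimal paths, which may contain cycles, have a finite bounded number of edge transitions. -/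
open ENNReal

/-- Travel time of the path `s, L₀, L₁, …` departing from `s` at time `t`: the
arrival times are `a₀ = t`, `a_{i+1} = a_i + c_{s_i s_{i+1}}(a_i)` (with `∞`
absorbing), and the travel time is `a_n − t ∈ [0, ∞]`. -/
noncomputable def pathTravel {S : Type*} (c : S → S → ℝ → ℝ≥0∞) :
    S → List S → ℝ → ℝ≥0∞
  | _, [], _ => 0
  | s, s' :: rest, t => c s s' t + pathTravel c s' rest (t + (c s s' t).toReal)

/-- A path with `n` edges has travel time at least `n * cmin`. -/
theorem pathTravel_lower_bound {S : Type*} (c : S → S → ℝ → ℝ≥0∞) (cmin : ℝ)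
    (hlb : ∀ s s' (t : ℝ), c s s' t ≠ ⊤ → ENNReal.ofReal cmin ≤ c s s' t) :
    ∀ (L : List S) (s : S) (t : ℝ),
      (L.length : ℝ≥0∞) * ENNReal.ofReal cmin ≤ pathTravel c s L t
  | [], s, t => by simp
  | s' :: rest, s, t => by
    have h1 : ENNReal.ofReal cmin ≤ c s s' t := by
      by_cases h : c s s' t = ⊤
      · rw [h]; exact le_top
      · exact hlb s s' t h
    have h2 := pathTravel_lower_bound c cmin hlb rest s' (t + (c s s' t).toReal)
    rw [pathTravel, List.length_cons, Nat.cast_succ, add_mul, one_mul, add_comm]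
    exact add_le_add h1 h2

/-- suppose every finite value of every edge travel time function is at
least `c_min > 0`. Fix a state `s`, a departure time `t`, and a path from `s` to a
goal state with finite travel time `T` at departure time `t`. Then every path from `s`
to a goal state with more than `T / c_min` edges has travel time strictly greater
than `T` at departure time `t`; consequently, the infimum of travel time over all
paths from `s` to a goal state at departure time `t` is attained by a path with at
most `⌊T / c_min⌋` edges. In particular, optimal paths, which may contain cycles,
have a finite bounded number of edge transitions. -/
theorem optimal_path_length_bound {S : Type*} [Fintype S]
    (c : S → S → ℝ → ℝ≥0∞) (goal : Set S) (hgoal : goal.Nonempty)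
    (hc0 : ∀ s s' (t : ℝ), t ≤ 0 → c s s' t = ⊤)
    (cmin : ℝ) (hcmin : 0 < cmin)
    (hlb : ∀ s s' (t : ℝ), c s s' t ≠ ⊤ → ENNReal.ofReal cmin ≤ c s s' t)
    (s : S) (t : ℝ) (L₀ : List S)
    (hL₀ : (s :: L₀).getLast (List.cons_ne_nil s L₀) ∈ goal)
    (hfin : pathTravel c s L₀ t ≠ ⊤) :
    (∀ L : List S, (s :: L).getLast (List.cons_ne_nil s L) ∈ goal →
      (pathTravel c s L₀ t).toReal / cmin < (L.length : ℝ) →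
      pathTravel c s L₀ t < pathTravel c s L t) ∧
    ∃ L : List S, (s :: L).getLast (List.cons_ne_nil s L) ∈ goal ∧
      L.length ≤ ⌊(pathTravel c s L₀ t).toReal / cmin⌋₊ ∧
      pathTravel c s L t =
        sInf {x : ℝ≥0∞ | ∃ L' : List S,
          (s :: L').getLast (List.cons_ne_nil s L') ∈ goal ∧
          x = pathTravel c s L' t} := by
  have key : ∀ L : List S, (s :: L).getLast (List.cons_ne_nil s L) ∈ goal →
      (pathTravel c s L₀ t).toReal / cmin < (L.length : ℝ) →
      pathTravel c s L₀ t < pathTravel c s L t := by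
    intro L _ hlen
    refine lt_of_lt_of_le ?_ (pathTravel_lower_bound c cmin hlb L s t)
    rw [div_lt_iff₀ hcmin] at hlen
    have h0 : (0 : ℝ) < L.length * cmin := lt_of_le_of_lt ENNReal.toReal_nonneg hlen
    have h1 : pathTravel c s L₀ t < ENNReal.ofReal (L.length * cmin) :=
      (ENNReal.lt_ofReal_iff_toReal_lt hfin).2 hlen
    rwa [ENNReal.ofReal_mul (Nat.cast_nonneg _), ENNReal.ofReal_natCast] at h1
  refine ⟨key, ?_⟩
  have short : ∀ L : List S, (s :: L).getLast (List.cons_ne_nil s L) ∈ goal →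
      pathTravel c s L t ≤ pathTravel c s L₀ t →
      L.length ≤ ⌊(pathTravel c s L₀ t).toReal / cmin⌋₊ := by
    intro L hL hle
    refine Nat.le_floor ?_
    by_contra hlt
    exact absurd (key L hL (not_le.1 hlt)) (not_lt.2 hle)
  have hF : {L : List S | L.length ≤ ⌊(pathTravel c s L₀ t).toReal / cmin⌋₊ ∧
      (s :: L).getLast (List.cons_ne_nil s L) ∈ goal}.Finite :=
    (List.finite_length_le S _).subset fun L hL => hL.1
  obtain ⟨M, ⟨hMlen, hMgoal⟩, hMmin⟩ := Set.exists_min_image _ (fun L => pathTravel c s L t) hF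
    ⟨L₀, short L₀ hL₀ le_rfl, hL₀⟩
  refine ⟨M, hMgoal, hMlen, le_antisymm ?_ (sInf_le ⟨M, hMgoal, rfl⟩)⟩
  refine le_sInf ?_
  rintro x ⟨L, hL, rfl⟩
  rcases le_total (pathTravel c s L t) (pathTravel c s L₀ t) with h | h
  · exact hMmin L ⟨short L hL h, hL⟩
  · exact (hMmin L₀ ⟨short L₀ hL₀ le_rfl, hL₀⟩).trans h
end

section
/- In a time-dependent graph, suppose there is c_min > 0 such that every finite value of every edge travel time function c_{s s'} is at least c_min. Then for every state s and every departure time t, the sequence (T^k_s(t))_{k ≥ 0} is eventually constant: there exists a finite K such that T^k_s(t) = T^K_s(t) for all k ≥ K, and this limit value equals the infimum of travel time over all paths from s to a goal state at departure time t. -/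
open ENNReal

/-- `k`-step optimal travel time: the infimum, over all paths from `s` with at most
`k` edges whose final state is a goal state, of the travel time at departure
time `t` (`∞` if no such path exists). -/
noncomputable def Tstep {S : Type*} (c : S → S → ℝ → ℝ≥0∞) (goal : Set S)
    (k : ℕ) (s : S) (t : ℝ) : ℝ≥0∞ :=
  sInf {x : ℝ≥0∞ | ∃ L : List S, L.length ≤ k ∧
    (s :: L).getLast (List.cons_ne_nil s L) ∈ goal ∧
    x = pathTravel c s L t}

theorem pathTravel_lower {S : Type*} (c : S → S → ℝ → ℝ≥0∞) (m : ℝ≥0∞)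
    (h : ∀ s s' t, m ≤ c s s' t) (L : List S) :
    ∀ s t, (L.length : ℝ≥0∞) * m ≤ pathTravel c s L t := by
  induction L with
  | nil => intro s t; simp
  | cons a L ih =>
    intro s t
    simp only [pathTravel, List.length_cons]
    push_cast
    rw [add_mul, one_mul, add_comm]
    exact add_le_add (h _ _ _) (ih _ _)

/-- suppose every finite value of every edge travel time function is at
least `c_min > 0`. Then for every state `s` and every departure time `t` the sequence
`(T^k_s(t))_{k ≥ 0}` is eventually constant: there exists a finite `K` with
`T^k_s(t) = T^K_s(t)` for all `k ≥ K`, and this limit value equals the infimum of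
travel time over all paths from `s` to a goal state at departure time `t`. -/
theorem Tstep_eventually_constant {S : Type*} [Fintype S]
    (c : S → S → ℝ → ℝ≥0∞) (goal : Set S) (hgoal : goal.Nonempty)
    (hc0 : ∀ s s' (t : ℝ), t ≤ 0 → c s s' t = ⊤)
    (cmin : ℝ) (hcmin : 0 < cmin)
    (hlb : ∀ s s' (t : ℝ), c s s' t ≠ ⊤ → ENNReal.ofReal cmin ≤ c s s' t) :
    ∀ (s : S) (t : ℝ), ∃ K : ℕ,
      (∀ k ≥ K, Tstep c goal k s t = Tstep c goal K s t) ∧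
      Tstep c goal K s t =
        sInf {x : ℝ≥0∞ | ∃ L : List S,
          (s :: L).getLast (List.cons_ne_nil s L) ∈ goal ∧
          x = pathTravel c s L t} := by
  intro s t
  have hm : ∀ s s' t, ENNReal.ofReal cmin ≤ c s s' t := by
    intro s s' t
    by_cases h : c s s' t = ⊤
    · rw [h]; exact le_top
    · exact hlb s s' t h
  have hm0 : ENNReal.ofReal cmin ≠ 0 := by simpa using hcmin
  set I := sInf {x : ℝ≥0∞ | ∃ L : List S,
          (s :: L).getLast (List.cons_ne_nil s L) ∈ goal ∧
          x = pathTravel c s L t} with hI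
  have hge : ∀ k, I ≤ Tstep c goal k s t := by
    intro k
    apply sInf_le_sInf
    rintro x ⟨L, _, h1, h2⟩
    exact ⟨L, h1, h2⟩
  have hanti : ∀ k K, K ≤ k → Tstep c goal k s t ≤ Tstep c goal K s t := by
    intro k K hk
    apply sInf_le_sInf
    rintro x ⟨L, h0, h1, h2⟩
    exact ⟨L, h0.trans hk, h1, h2⟩
  suffices h : ∃ K, Tstep c goal K s t ≤ I by
    obtain ⟨K, hK⟩ := h
    exact ⟨K, fun k hk => le_antisymm (hanti k K hk) (hK.trans (hge k)),
      le_antisymm hK (hge K)⟩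
  by_cases hfin : ∃ L : List S, (s :: L).getLast (List.cons_ne_nil s L) ∈ goal ∧
      pathTravel c s L t ≠ ⊤
  · obtain ⟨L0, hg, hL0⟩ := hfin
    obtain ⟨n, hn⟩ := ENNReal.exists_nat_mul_gt hm0 hL0
    refine ⟨max L0.length n, le_sInf ?_⟩
    rintro x ⟨L, hL, rfl⟩
    by_cases hlen : L.length ≤ max L0.length n
    · exact sInf_le ⟨L, hlen, hL, rfl⟩
    · have h1 : Tstep c goal (max L0.length n) s t ≤ pathTravel c s L0 t :=
        sInf_le ⟨L0, le_max_left _ _, hg, rfl⟩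
      have hnl : n ≤ L.length := by omega
      have h2 : (n : ℝ≥0∞) * ENNReal.ofReal cmin ≤ L.length * ENNReal.ofReal cmin := by
        gcongr
      exact h1.trans (hn.le.trans (h2.trans (pathTravel_lower c _ hm L s t)))
  · refine ⟨0, le_sInf ?_⟩
    rintro x ⟨L, hL, rfl⟩
    have : pathTravel c s L t = ⊤ := by
      by_contra h
      exact hfin ⟨L, hL, h⟩
    rw [this]
    exact le_top
end

section
/- Consider a time-dependent graph in which, for each ordered pair (s, s'), the edge travel time function c_{s s'} is piecewise constant with respect to a finite set B_{s s'} ⊆ [0, ∞) containing 0, has all of its finite values contained in a finite set V_{s s'} ⊆ [0, ∞), and equals ∞ on (−∞, 0]. Define D_{s s'} = B_{s s'} ∪ V_{s s'} and let P^k_s be the associated subdomain sets. Then for every k ≥ 0 and every state s, the k-step optimal travel time function T^k_s is piecewise constant with respect to the finite set P^k_s. -/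
open ENNReal

theorem pcw_of_uIcc {f : ℝ → ℝ≥0∞} {P : Set ℝ}
    (h : ∀ x y, Set.uIcc x y ⊆ Pᶜ → f y = f x) : PiecewiseConstantWrt f P := by
  intro x hx y hy
  apply h
  have hc : (connectedComponentIn Pᶜ x).OrdConnected :=
    isPreconnected_connectedComponentIn.ordConnected
  exact (hc.uIcc_subset (mem_connectedComponentIn hx) hy).trans
    (connectedComponentIn_subset _ _)

theorem uIcc_of_pcw {f : ℝ → ℝ≥0∞} {P : Set ℝ} (h : PiecewiseConstantWrt f P)
    (x y : ℝ) (hxy : Set.uIcc x y ⊆ Pᶜ) : f y = f x := by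
  apply h x (hxy Set.left_mem_uIcc)
  exact isPreconnected_uIcc.subset_connectedComponentIn Set.left_mem_uIcc hxy
    Set.right_mem_uIcc

theorem pathTravel_const {S : Type*}
    (c : S → S → ℝ → ℝ≥0∞)
    (B V : S → S → Finset ℝ)
    (hVnn : ∀ s s', ∀ v ∈ V s s', (0 : ℝ) ≤ v)
    (hcpc : ∀ s s', PiecewiseConstantWrt (c s s') (B s s' : Set ℝ))
    (hcV : ∀ s s' (t : ℝ), c s s' t ≠ ⊤ → ∃ v ∈ V s s', c s s' t = ENNReal.ofReal v)
    (hc0 : ∀ s s' (t : ℝ), t ≤ 0 → c s s' t = ⊤) :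
    ∀ (k : ℕ) (s : S) (L : List S), L.length ≤ k → ∀ x y : ℝ,
      Set.uIcc x y ⊆ (subP (fun s s' => B s s' ∪ V s s') k s)ᶜ →
      pathTravel c s L y = pathTravel c s L x := by
  intro k
  induction k with
  | zero =>
    intro s L hL x y _
    obtain rfl : L = [] := List.length_eq_zero_iff.mp (by omega)
    rfl
  | succ k ih =>
    intro s L hL x y hxy
    cases L with
    | nil => rfl
    | cons s' rest =>
      have hc : c s s' y = c s s' x := by
        refine uIcc_of_pcw (hcpc s s') x y (fun z hz hzB => hxy hz ?_)
        refine Or.inl (Or.inr (Set.mem_iUnion.mpr ⟨s', ?_⟩))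
        simp only [Finset.coe_union]
        exact Or.inl hzB
      simp only [pathTravel]
      rw [hc]
      by_cases ht : c s s' x = ⊤
      · simp [ht]
      · have hx : 0 < x := by
          by_contra hx
          exact ht (hc0 s s' x (not_lt.mp hx))
        have hy : 0 < y := by
          by_contra hy
          exact ht (hc ▸ hc0 s s' y (not_lt.mp hy))
        obtain ⟨v, hv, hcv⟩ := hcV s s' x ht
        rw [hcv, ENNReal.toReal_ofReal (hVnn s s' v hv)]
        congr 1
        apply ih s' rest (by simpa using hL)
        intro z hz hzP
        have hz' : z - v ∈ Set.uIcc x y := by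
          rw [Set.mem_uIcc] at hz ⊢
          rcases hz with hz | hz
          · left; constructor <;> linarith [hz.1, hz.2]
          · right; constructor <;> linarith [hz.1, hz.2]
        refine hxy hz' (Or.inr (Set.mem_iUnion.mpr
          ⟨s', z, hzP, v, Finset.mem_union_right _ hv, rfl, ?_⟩))
        rw [Set.mem_uIcc] at hz'
        rcases hz' with hz' | hz' <;> linarith [hz'.1]

/-- suppose each edge travel time function `c_{s s'}` is piecewise
constant w.r.t. a finite set `B_{s s'} ⊆ [0, ∞)` containing `0`, has all of its
finite values in a finite set `V_{s s'} ⊆ [0, ∞)`, and equals `∞` on `(−∞, 0]`.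
With `D_{s s'} = B_{s s'} ∪ V_{s s'}` and the associated subdomain sets `P^k_s`,
for every `k ≥ 0` and state `s` the `k`-step optimal travel time function `T^k_s`
is piecewise constant w.r.t. the finite set `P^k_s`. -/
theorem Tstep_piecewiseConstant {S : Type*} [Fintype S]
    (c : S → S → ℝ → ℝ≥0∞) (goal : Set S) (hgoal : goal.Nonempty)
    (B V : S → S → Finset ℝ)
    (hB0 : ∀ s s', (0 : ℝ) ∈ B s s')
    (hBnn : ∀ s s', ∀ b ∈ B s s', (0 : ℝ) ≤ b)
    (hVnn : ∀ s s', ∀ v ∈ V s s', (0 : ℝ) ≤ v)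
    (hcpc : ∀ s s', PiecewiseConstantWrt (c s s') (B s s' : Set ℝ))
    (hcV : ∀ s s' (t : ℝ), c s s' t ≠ ⊤ → ∃ v ∈ V s s', c s s' t = ENNReal.ofReal v)
    (hc0 : ∀ s s' (t : ℝ), t ≤ 0 → c s s' t = ⊤) :
    ∀ (k : ℕ) (s : S),
      PiecewiseConstantWrt (Tstep c goal k s)
        (subP (fun s s' => B s s' ∪ V s s') k s) := by
  intro k s
  apply pcw_of_uIcc
  intro x y hxy
  have h := fun L hL =>
    pathTravel_const c B V hVnn hcpc hcV hc0 k s L hL x y hxy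
  unfold Tstep
  congr 1
  ext a
  constructor
  · rintro ⟨L, hL, hg, rfl⟩
    exact ⟨L, hL, hg, h L hL⟩
  · rintro ⟨L, hL, hg, rfl⟩
    exact ⟨L, hL, hg, (h L hL).symm⟩
end
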